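/- arXiv:1203.1014 — 3 statements merged into one kernel-verified Lean document; each statement's English description precedes it below -/
import Mathlib

section
/- (Nash-Williams; Tutte) A finite connected simple graph G has at least k pairwise edge-disjoint spanning trees if and only if for every partition of the vertex set of G into r nonempty parts, the number of edges of G whose two endpoints lie in different parts is at least k(r − 1). -/
open Set

namespace MaxSTP

variable {V : Type*}

/-- `T` is a spanning tree of `G`: a spanning subgraph of `G` (on the same vertex
set) that is a tree. -/
def IsSpanningTreeOf (G T : SimpleGraph V) : Prop := T ≤ G ∧ T.IsTree

/-- `G` has `k` pairwise edge-disjoint spanning trees. -/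
def HasDisjointSpanningTrees (G : SimpleGraph V) (k : ℕ) : Prop :=
  ∃ T : Fin k → SimpleGraph V, (∀ i, IsSpanningTreeOf G (T i)) ∧
    Pairwise (Function.onFun Disjoint fun i => (T i).edgeSet)

/-- The edges of `G` whose endpoints have different images under `f`. -/
def crossingEdges {α : Type*} (G : SimpleGraph V) (f : V → α) : Set (Sym2 V) :=
  {e ∈ G.edgeSet | ∃ u v, e = s(u, v) ∧ f u ≠ f v}

lemma le_ncard_crossingEdges_add_one [Finite V] {T : SimpleGraph V} (hT : T.Connected)
    {r : ℕ} {f : V → Fin r} (hf : Function.Surjective f) :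
    r ≤ (crossingEdges T f).ncard + 1 := by
  let Q := SimpleGraph.fromEdgeSet (Sym2.map f '' T.edgeSet)
  have hwalk : ∀ u v, T.Reachable u v → Q.Reachable (f u) (f v) := by
    rintro u v ⟨p⟩
    induction p with
    | nil => exact .rfl
    | @cons u v w h p ih =>
      refine SimpleGraph.Reachable.trans ?_ ih
      by_cases huv : f u = f v
      · rw [huv]
      · exact SimpleGraph.Adj.reachable ⟨⟨s(u, v), h, rfl⟩, huv⟩
  have hQ : Q.Connected := by
    have : Nonempty (Fin r) := hT.nonempty.map f
    refine ⟨fun a b => ?_⟩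
    obtain ⟨u, rfl⟩ := hf a
    obtain ⟨v, rfl⟩ := hf b
    exact hwalk u v (hT u v)
  have hcard := hQ.card_vert_le_card_edgeSet_add_one
  rw [Nat.card_fin, Nat.card_coe_set_eq] at hcard
  have hsub : Q.edgeSet ⊆ Sym2.map f '' crossingEdges T f := by
    intro e he
    rw [SimpleGraph.edgeSet_fromEdgeSet] at he
    obtain ⟨⟨d, hd, rfl⟩, hdiag⟩ := he
    induction d with
    | _ u v => exact ⟨s(u, v), ⟨hd, u, v, rfl, by simpa using hdiag⟩, rfl⟩
  have := (ncard_le_ncard hsub).trans (ncard_image_le (toFinite _))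
  omega

lemma card_le_ncard_edgeSet_add [Finite V] [Nonempty V] {A : SimpleGraph V} {r : ℕ}
    {f : V → Fin r} (hf : Function.Surjective f)
    (hA : ∀ u v, f u = f v → A.Reachable u v) :
    Nat.card V ≤ A.edgeSet.ncard + r := by
  obtain ⟨g, hg⟩ := hf.hasRightInverse
  obtain ⟨v₀⟩ := ‹Nonempty V›
  let S : Set (Sym2 V) := (fun c => s(g (f v₀), g c)) '' ({f v₀}ᶜ : Set (Fin r))
  let B := A ⊔ SimpleGraph.fromEdgeSet S
  have hreach : ∀ v, B.Reachable (g (f v₀)) v := by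
    intro v
    have h₁ : B.Reachable (g (f v)) v := (hA _ _ (hg _)).mono le_sup_left
    refine SimpleGraph.Reachable.trans ?_ h₁
    by_cases h : f v = f v₀
    · rw [h]
    · refine SimpleGraph.Adj.reachable (Or.inr ⟨⟨f v, h, rfl⟩, fun h' => h ?_⟩)
      rw [← hg (f v), ← h', hg]
  have hB : B.Connected :=
    { preconnected := fun u v => (hreach u).symm.trans (hreach v), nonempty := ⟨v₀⟩ }
  have hcard := hB.card_vert_le_card_edgeSet_add_one
  have hsub : B.edgeSet ⊆ A.edgeSet ∪ S := by
    rw [SimpleGraph.edgeSet_sup, SimpleGraph.edgeSet_fromEdgeSet]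
    exact union_subset_union_right _ sdiff_subset
  have h₁ := (ncard_le_ncard hsub).trans (ncard_union_le _ _)
  have h₂ : S.ncard ≤ r - 1 := by
    refine (ncard_image_le (toFinite _)).trans ?_
    rw [ncard_compl]
    simp
  have : 0 < r := (f v₀).pos
  rw [Nat.card_coe_set_eq] at hcard
  omega

section Coloring

variable {ι : Type*}

/-- The subgraph of the edges of `G` that are assigned the colour `i`. -/
def colorClass (G : SimpleGraph V) (c : Sym2 V → Option ι) (i : ι) : SimpleGraph V where
  Adj u v := G.Adj u v ∧ c s(u, v) = some i
  symm := ⟨fun u _ h => ⟨h.1.symm, Sym2.eq_swap (a := u) ▸ h.2⟩⟩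
  loopless := ⟨fun _ h => h.1.ne rfl⟩

/-- The edges of `G` without a colour. -/
def uncolored (G : SimpleGraph V) (c : Sym2 V → Option ι) : Set (Sym2 V) :=
  {e ∈ G.edgeSet | c e = none}

/-- A partial edge colouring all of whose colour classes are forests. -/
def IsForestColoring (G : SimpleGraph V) (c : Sym2 V → Option ι) : Prop :=
  ∀ i, (colorClass G c i).IsAcyclic

/-- A forest colouring with as few uncoloured edges as possible. -/
def IsOptimal (G : SimpleGraph V) (c : Sym2 V → Option ι) : Prop :=
  IsForestColoring G c ∧
    ∀ c' : Sym2 V → Option ι, IsForestColoring G c' →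
      (uncolored G c).ncard ≤ (uncolored G c').ncard

open Classical in
/-- `c'` is a forest colouring obtained from `c` by moving a colour from one edge to an
uncoloured edge. -/
def Exchange (G : SimpleGraph V) (c c' : Sym2 V → Option ι) : Prop :=
  IsForestColoring G c' ∧ ∃ i, ∃ e ∈ uncolored G c, ∃ d ∈ G.edgeSet, c d = some i ∧
    c' = Function.update (Function.update c d none) e (some i)

/-- The edges of `G` that are uncoloured in some colouring reachable from `c₀` by exchanges. -/
def freeGraph (G : SimpleGraph V) (c₀ : Sym2 V → Option ι) : SimpleGraph V where
  Adj u v := G.Adj u v ∧ ∃ c, Relation.ReflTransGen (Exchange G) c₀ c ∧ c s(u, v) = none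
  symm := ⟨fun u _ h => ⟨h.1.symm, Sym2.eq_swap (a := u) ▸ h.2⟩⟩
  loopless := ⟨fun _ h => h.1.ne rfl⟩

lemma exists_isOptimal [Finite V] [Finite ι] (G : SimpleGraph V) :
    ∃ c : Sym2 V → Option ι, IsOptimal G c := by
  have hne : {c : Sym2 V → Option ι | IsForestColoring G c}.Nonempty := by
    refine ⟨fun _ => none, fun i => ?_⟩
    have : colorClass G (fun _ => none) i = ⊥ := by
      ext u v
      simp [colorClass]
    rw [this]
    exact SimpleGraph.isAcyclic_bot
  obtain ⟨c, hc, hmin⟩ := exists_min_image _ (fun c => (uncolored G c).ncard) (toFinite _) hne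
  exact ⟨c, hc, hmin⟩

lemma colorClass_le (G : SimpleGraph V) (c : Sym2 V → Option ι) (i : ι) :
    colorClass G c i ≤ G := fun _ _ h => h.1

lemma mem_edgeSet_colorClass {G : SimpleGraph V} {c : Sym2 V → Option ι} {i : ι} {e : Sym2 V} :
    e ∈ (colorClass G c i).edgeSet ↔ e ∈ G.edgeSet ∧ c e = some i := by
  induction e with
  | _ u v => rfl

/-- Recolouring an edge of a forest colouring gives a forest colouring as soon as the ends of
the edge are not connected in its new colour class. -/
lemma IsForestColoring.update [DecidableEq (Sym2 V)] {G : SimpleGraph V}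
    {c : Sym2 V → Option ι} (hc : IsForestColoring G c) {x y : V} {i : ι}
    (hxy : ¬ (colorClass G c i).Reachable x y) :
    IsForestColoring G (Function.update c s(x, y) (some i)) := by
  intro j
  by_cases hj : j = i
  · subst hj
    refine ((hc j).sup_edge_of_not_reachable hxy).anti fun u v h => ?_
    obtain ⟨hG, h⟩ := h
    by_cases he : s(u, v) = s(x, y)
    · exact Or.inr ((SimpleGraph.edge_adj ..).2 ⟨by simpa using he, hG.ne⟩)
    · exact Or.inl ⟨hG, by rwa [Function.update_of_ne he] at h⟩
  · refine (hc j).anti fun u v h => ?_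
    obtain ⟨hG, h⟩ := h
    by_cases he : s(u, v) = s(x, y)
    · rw [he, Function.update_self] at h
      exact absurd (Option.some.inj h).symm hj
    · exact ⟨hG, by rwa [Function.update_of_ne he] at h⟩

lemma IsForestColoring.update_none [DecidableEq (Sym2 V)] {G : SimpleGraph V}
    {c : Sym2 V → Option ι} (hc : IsForestColoring G c) (d : Sym2 V) :
    IsForestColoring G (Function.update c d none) := by
  intro j
  refine (hc j).anti fun u v h => ?_
  obtain ⟨hG, h⟩ := h
  by_cases he : s(u, v) = d
  · simp [he] at h
  · exact ⟨hG, by rwa [Function.update_of_ne he] at h⟩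

lemma IsOptimal.reachable [Finite V] {G : SimpleGraph V} {c : Sym2 V → Option ι}
    (hc : IsOptimal G c) {x y : V} (hxy : s(x, y) ∈ uncolored G c) (i : ι) :
    (colorClass G c i).Reachable x y := by
  classical
  by_contra h
  refine (hc.2 _ (hc.1.update h)).not_gt (ncard_lt_ncard (ssubset_of_subset_not_subset ?_ ?_))
  · rintro e ⟨he, hn⟩
    refine ⟨he, ?_⟩
    by_cases h' : e = s(x, y)
    · simp [h'] at hn
    · rwa [Function.update_of_ne h'] at hn
  · intro hsub
    simpa using (hsub hxy).2

lemma Exchange.isOptimal [Finite V] {G : SimpleGraph V} {c c' : Sym2 V → Option ι}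
    (h : Exchange G c c') (hc : IsOptimal G c) : IsOptimal G c' := by
  obtain ⟨hc', i, e, he, d, hd, hdi, h⟩ := h
  refine ⟨hc', fun c'' hc'' => le_trans ?_ (hc.2 c'' hc'')⟩
  have hsub : uncolored G c' ⊆ insert d (uncolored G c \ {e}) := by
    rintro a ⟨ha, hn⟩
    by_cases hae : a = e
    · simp [h, hae] at hn
    · by_cases had : a = d
      · exact Or.inl had
      · refine Or.inr ⟨⟨ha, ?_⟩, hae⟩
        simpa [h, hae, had] using hn
  have h₁ := (ncard_le_ncard hsub).trans (ncard_insert_le _ _)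
  rwa [ncard_sdiff_singleton_add_one he] at h₁

lemma isOptimal_of_reflTransGen [Finite V] {G : SimpleGraph V} {c c' : Sym2 V → Option ι}
    (h : Relation.ReflTransGen (Exchange G) c c') (hc : IsOptimal G c) : IsOptimal G c' := by
  induction h with
  | refl => exact hc
  | tail _ h ih => exact h.isOptimal ih

/-- In a forest, an edge of the path from `x` to `y` separates `x` from `y`. -/
lemma not_reachable_of_mem_edges {F F' : SimpleGraph V} (hF : F.IsAcyclic) (hle : F' ≤ F)
    {x y : V} (p : F.Path x y) {d : Sym2 V} (hd : d ∈ (p : F.Walk x y).edges)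
    (hd' : d ∉ F'.edgeSet) : ¬ F'.Reachable x y := by
  classical
  rintro ⟨q⟩
  have hq : (q.toPath : F'.Walk x y).mapLe hle = p :=
    congrArg Subtype.val
      ((hF.subsingleton_path x y).elim ⟨_, q.toPath.isPath.mapLe hle⟩ p)
  rw [← hq, SimpleGraph.Walk.edges_mapLe_eq_edges] at hd
  exact hd' (SimpleGraph.Walk.edges_subset_edgeSet _ hd)

lemma reachable_inf_freeGraph [Finite V] {G : SimpleGraph V} {c₀ c : Sym2 V → Option ι}
    (h₀ : IsOptimal G c₀) (hc : Relation.ReflTransGen (Exchange G) c₀ c) {x y : V}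
    (hxy : s(x, y) ∈ uncolored G c) (i : ι) :
    (colorClass G c i ⊓ freeGraph G c₀).Reachable x y := by
  classical
  have hopt := isOptimal_of_reflTransGen hc h₀
  obtain ⟨p⟩ := hopt.reachable hxy i
  have key : ∀ d ∈ (p.toPath : (colorClass G c i).Walk x y).edges,
      d ∈ (colorClass G c i ⊓ freeGraph G c₀).edgeSet := by
    intro d hd
    have hdF := SimpleGraph.Walk.edges_subset_edgeSet _ hd
    obtain ⟨hdG, hdi⟩ := mem_edgeSet_colorClass.1 hdF
    have hdxy : d ≠ s(x, y) := by
      rintro rfl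
      simp [hxy.2] at hdi
    rw [SimpleGraph.edgeSet_inf]
    refine ⟨hdF, ?_⟩
    have hle : colorClass G (Function.update c d none) i ≤ colorClass G c i := by
      rintro u v ⟨hG, h⟩
      by_cases he : s(u, v) = d
      · simp [he] at h
      · exact ⟨hG, by rwa [Function.update_of_ne he] at h⟩
    have hnr : ¬ (colorClass G (Function.update c d none) i).Reachable x y :=
      not_reachable_of_mem_edges (hopt.1 i) hle _ hd fun h => by
        simpa using (mem_edgeSet_colorClass.1 h).2
    have hex : Exchange G c
        (Function.update (Function.update c d none) s(x, y) (some i)) :=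
      ⟨by convert (hopt.1.update_none d).update hnr, i, _, hxy, d, hdG, hdi, by congr!⟩
    induction d with
    | _ u v => exact ⟨hdG, _, hc.tail hex, by simp [hdxy]⟩
  exact ⟨(p.toPath : (colorClass G c i).Walk x y).transfer _ key⟩

lemma reachable_of_forall_adj {G H : SimpleGraph V} (h : ∀ u v, G.Adj u v → H.Reachable u v)
    {x y : V} (hxy : G.Reachable x y) : H.Reachable x y := by
  obtain ⟨p⟩ := hxy
  induction p with
  | nil => exact .rfl
  | cons hadj _ ih => exact (h _ _ hadj).trans ih

lemma reachable_inf_freeGraph_of_reachable [Finite V] {G : SimpleGraph V}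
    {c₀ c : Sym2 V → Option ι} (h₀ : IsOptimal G c₀)
    (hc : Relation.ReflTransGen (Exchange G) c₀ c) (i : ι) {x y : V}
    (hxy : (colorClass G c i ⊓ freeGraph G c₀).Reachable x y) :
    (colorClass G c₀ i ⊓ freeGraph G c₀).Reachable x y := by
  classical
  induction hc generalizing x y with
  | refl => exact hxy
  | @tail c c' hc hex ih =>
    refine ih (reachable_of_forall_adj (fun u v huv => ?_) hxy)
    obtain ⟨⟨hG, hi⟩, hfree⟩ := huv
    obtain ⟨-, j, e, he, d, -, -, rfl⟩ := hex
    by_cases hue : s(u, v) = e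
    · exact reachable_inf_freeGraph h₀ hc (hue ▸ he) i
    · by_cases hud : s(u, v) = d
      · rw [Function.update_of_ne hue, hud, Function.update_self] at hi
        cases hi
      · rw [Function.update_of_ne hue, Function.update_of_ne hud] at hi
        exact SimpleGraph.Adj.reachable ⟨⟨hG, hi⟩, hfree⟩

/-- Every colour class of an optimal colouring spans the free graph. -/
lemma IsOptimal.reachable_of_freeGraph [Finite V] {G : SimpleGraph V} {c : Sym2 V → Option ι}
    (hc : IsOptimal G c) (i : ι) {x y : V} (hxy : (freeGraph G c).Reachable x y) :
    (colorClass G c i ⊓ freeGraph G c).Reachable x y := by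
  refine reachable_of_forall_adj (fun u v huv => ?_) hxy
  obtain ⟨hG, c', hc', hn⟩ := huv
  exact reachable_inf_freeGraph_of_reachable hc hc' i
    (reachable_inf_freeGraph hc hc' ⟨hG, hn⟩ i)

end Coloring

lemma ncard_edgeSet_add_one_of_isTree [Finite V] {T : SimpleGraph V} (hT : T.IsTree) :
    T.edgeSet.ncard + 1 = Nat.card V := by
  rw [← Nat.card_coe_set_eq]
  exact (SimpleGraph.isTree_iff_connected_and_card.1 hT).2

lemma exists_coloring_isTree [Finite V] {G : SimpleGraph V} (hG : G.Connected) {k : ℕ}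
    (h : ∀ (r : ℕ) (f : V → Fin r), Function.Surjective f →
      k * (r - 1) ≤ (crossingEdges G f).ncard) :
    ∃ c : Sym2 V → Option (Fin k), ∀ i, (colorClass G c i).IsTree := by
  have := hG.nonempty
  obtain ⟨c, hc⟩ := exists_isOptimal (ι := Fin k) G
  refine ⟨c, ?_⟩
  choose T hFT hTG hT using fun i =>
    hG.exists_isTree_le_of_le_of_isAcyclic (colorClass_le G c i) (hc.1 i)
  let H := freeGraph G c
  obtain ⟨r, ⟨φ⟩⟩ := Finite.exists_equiv_fin H.ConnectedComponent
  let f : V → Fin r := fun v => φ (H.connectedComponentMk v)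
  have hf : Function.Surjective f := φ.surjective.comp Quot.mk_surjective
  have hfH : ∀ u v, f u = f v ↔ H.Reachable u v := fun u v => by simp [f]
  have hr : 0 < r := (f (Classical.arbitrary V)).pos
  have hspan : ∀ i, Nat.card V ≤ (colorClass G c i ⊓ H).edgeSet.ncard + r := fun i =>
    card_le_ncard_edgeSet_add hf fun u v huv =>
      hc.reachable_of_freeGraph i ((hfH u v).1 huv)
  have hsplit : ∀ i, (colorClass G c i ⊓ H).edgeSet.ncard +
      (crossingEdges (colorClass G c i) f).ncard ≤ (colorClass G c i).edgeSet.ncard := by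
    intro i
    rw [← ncard_union_eq]
    · refine ncard_le_ncard (union_subset ?_ fun e he => he.1)
      exact SimpleGraph.edgeSet_mono inf_le_left
    · rw [disjoint_left]
      rintro e he ⟨-, u, v, rfl, huv⟩
      exact huv ((hfH u v).2 (SimpleGraph.Adj.reachable he.2))
  have hle : ∀ i, (colorClass G c i).edgeSet.ncard + 1 ≤ Nat.card V := by
    intro i
    rw [← ncard_edgeSet_add_one_of_isTree (hT i)]
    gcongr
    · exact toFinite _
    · exact hFT i
  have hcover : crossingEdges G f ⊆ ⋃ i, crossingEdges (colorClass G c i) f := by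
    rintro e ⟨he, u, v, rfl, huv⟩
    rw [mem_iUnion]
    cases hce : c s(u, v) with
    | none =>
      have hadj : H.Adj u v := ⟨he, c, .refl, hce⟩
      exact absurd ((hfH u v).2 hadj.reachable) huv
    | some i => exact ⟨i, ⟨he, hce⟩, u, v, rfl, huv⟩
  have hsum : k * (r - 1) ≤ ∑ i, (crossingEdges (colorClass G c i) f).ncard :=
    (h r f hf).trans <| (ncard_le_ncard hcover).trans <| by
      simpa using Finset.set_ncard_biUnion_le Finset.univ
        fun i => crossingEdges (colorClass G c i) f
  have hcross_le : ∀ i ∈ Finset.univ, (crossingEdges (colorClass G c i) f).ncard ≤ r - 1 := by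
    intro i _
    have := hspan i
    have := hsplit i
    have := hle i
    omega
  have hcross : ∀ i, (crossingEdges (colorClass G c i) f).ncard = r - 1 := by
    have hconst : ∑ _i : Fin k, (r - 1) = k * (r - 1) := by simp
    have := (Finset.sum_eq_sum_iff_of_le hcross_le).1
      (le_antisymm (Finset.sum_le_sum hcross_le) (hconst ▸ hsum))
    exact fun i => this i (Finset.mem_univ i)
  intro i
  have hcard : (T i).edgeSet.ncard ≤ (colorClass G c i).edgeSet.ncard := by
    have := hspan i
    have := hsplit i
    have := hcross i
    have := ncard_edgeSet_add_one_of_isTree (hT i)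
    omega
  have heq := eq_of_subset_of_ncard_le (SimpleGraph.edgeSet_mono (hFT i)) hcard
  rw [SimpleGraph.edgeSet_inj.1 heq]
  exact hT i

lemma HasDisjointSpanningTrees.le_ncard_crossingEdges [Finite V] {G : SimpleGraph V} {k : ℕ}
    (h : HasDisjointSpanningTrees G k) {r : ℕ} {f : V → Fin r} (hf : Function.Surjective f) :
    k * (r - 1) ≤ (crossingEdges G f).ncard := by
  obtain ⟨T, hT, hdisj⟩ := h
  have hsub : ⋃ i, crossingEdges (T i) f ⊆ crossingEdges G f :=
    iUnion_subset fun i e he => ⟨SimpleGraph.edgeSet_mono (hT i).1 he.1, he.2⟩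
  calc k * (r - 1) = ∑ _i : Fin k, (r - 1) := by simp
    _ ≤ ∑ i, (crossingEdges (T i) f).ncard := Finset.sum_le_sum fun i _ =>
      Nat.sub_le_iff_le_add.2 (le_ncard_crossingEdges_add_one (hT i).2.connected hf)
    _ = (⋃ i, crossingEdges (T i) f).ncard := by
      rw [← finsum_eq_sum_of_fintype]
      refine (ncard_iUnion_of_finite (fun i => toFinite _) fun i j hij => ?_).symm
      exact (hdisj hij).mono (fun e he => he.1) fun e he => he.1
    _ ≤ (crossingEdges G f).ncard := ncard_le_ncard hsub

end MaxSTP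

/-- (Nash-Williams; Tutte) A finite connected simple graph `G` has at least `k`
pairwise edge-disjoint spanning trees if and only if for every partition of its
vertex set into `r` nonempty parts (encoded as a surjection `f : V → Fin r`),
the number of edges of `G` whose endpoints lie in different parts is at least
`k (r - 1)`. -/
theorem nash_williams_tutte {V : Type*} [Fintype V]
    (G : SimpleGraph V) (hG : G.Connected) (k : ℕ) :
    MaxSTP.HasDisjointSpanningTrees G k ↔
      ∀ (r : ℕ) (f : V → Fin r), Function.Surjective f →
        k * (r - 1) ≤ {e ∈ G.edgeSet | ∃ u v, e = s(u, v) ∧ f u ≠ f v}.ncard := by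
  refine ⟨fun h r f hf => h.le_ncard_crossingEdges hf, fun h => ?_⟩
  obtain ⟨c, hc⟩ := MaxSTP.exists_coloring_isTree hG h
  refine ⟨MaxSTP.colorClass G c, fun i => ⟨MaxSTP.colorClass_le G c i, hc i⟩, fun i j hij => ?_⟩
  refine disjoint_left.2 fun e hi hj => hij ?_
  rw [MaxSTP.mem_edgeSet_colorClass] at hi hj
  exact Option.some.inj (hi.2.symm.trans hj.2)
end

section
/- (Gusfield) Let G be a finite connected simple graph such that deleting any set of fewer than 2k edges from G leaves a connected graph (i.e., G is 2k-edge-connected). Then G has k pairwise edge-disjoint spanning trees. Equivalently, λ(G) ≤ 2σ(G) for every finite connected simple graph G. -/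
open Set

namespace SimpleGraph

open Function

variable {V ι : Type*} {G H K : SimpleGraph V} {F F₀ F₁ : ι → SimpleGraph V}

/-- If every two adjacent vertices of `H` are reachable in `K`, then reachability in `H` implies
reachability in `K`. -/
theorem Reachable.of_forall_adj (h : ∀ ⦃a b⦄, H.Adj a b → K.Reachable a b) {u v : V}
    (huv : H.Reachable u v) : K.Reachable u v := by
  obtain ⟨p⟩ := huv
  induction p with
  | nil => rfl
  | cons hab _ ih => exact (h hab).trans ih

/-- Deleting an edge of the path joining `x` to `y` in a forest separates `x` from `y`. -/
theorem IsAcyclic.not_reachable_deleteEdges (hH : H.IsAcyclic) {x y : V} (p : H.Path x y)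
    {e : Sym2 V} (he : e ∈ p.1.edges) : ¬ (H.deleteEdges {e}).Reachable x y := by
  intro hr
  obtain ⟨q, hq⟩ := hr.exists_isPath
  have hpq : p = ⟨q.mapLe (deleteEdges_le _), hq.mapLe _⟩ := (hH.subsingleton_path x y).elim _ _
  rw [hpq] at he
  simp only [Walk.edges_mapLe_eq_edges] at he
  have := q.edges_subset_edgeSet he
  simp at this

/-- Deleting an edge of a finite forest increases the number of connected components. -/
theorem IsAcyclic.card_connectedComponent_lt [Finite V] (hH : H.IsAcyclic) {e : Sym2 V}
    (he : e ∈ H.edgeSet) :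
    Nat.card H.ConnectedComponent < Nat.card (H.deleteEdges {e}).ConnectedComponent := by
  induction e with
  | h a b =>
  have hsurj := ConnectedComponent.surjective_map_ofLE (deleteEdges_le (G := H) {s(a, b)})
  refine (Nat.card_le_card_of_surjective _ hsurj).lt_of_ne fun hcard ↦ ?_
  have hinj := ((Nat.bijective_iff_surjective_and_card _).2 ⟨hsurj, hcard.symm⟩).1
  refine isAcyclic_iff_forall_isBridge.1 hH he ?_
  exact ConnectedComponent.exact (hinj (ConnectedComponent.sound (Adj.reachable he)))

/-- A finite forest has at most as many edges outside a subgraph as the subgraph has additional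
components. -/
theorem IsAcyclic.ncard_edgeSet_sdiff_add_card_le [Finite V] (hH : H.IsAcyclic) (hKH : K ≤ H) :
    (H.edgeSet \ K.edgeSet).ncard + Nat.card H.ConnectedComponent ≤
      Nat.card K.ConnectedComponent := by
  induction hn : (H.edgeSet \ K.edgeSet).ncard generalizing H with
  | zero =>
    rw [Set.ncard_eq_zero, Set.sdiff_eq_empty, edgeSet_subset_edgeSet] at hn
    rw [le_antisymm hKH hn, zero_add]
  | succ n ih =>
    obtain ⟨e, he⟩ := Set.nonempty_of_ncard_ne_zero (hn.trans_ne n.succ_ne_zero)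
    have hK : K ≤ H.deleteEdges {e} := by
      rw [← edgeSet_subset_edgeSet, edgeSet_deleteEdges]
      exact Set.subset_sdiff_singleton (edgeSet_subset_edgeSet.2 hKH) he.2
    have hcard : ((H.deleteEdges {e}).edgeSet \ K.edgeSet).ncard = n := by
      rw [edgeSet_deleteEdges, Set.sdiff_sdiff_comm, Set.ncard_sdiff_singleton_of_mem he, hn,
        Nat.add_sub_cancel]
    have := ih (hH.anti (deleteEdges_le _)) hK hcard
    have := hH.card_connectedComponent_lt he.1
    omega

/-- If `G` remains connected after deleting fewer than `2 * k` edges, then at least `k * |ι|` edges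
run between different fibres of a surjection onto a nontrivial finite type `ι`. -/
theorem mul_card_le_ncard_crossing [Finite V] [Finite ι] [Nontrivial ι] {k : ℕ}
    (hG : ∀ D ⊆ G.edgeSet, D.ncard < 2 * k → (G.deleteEdges D).Connected)
    {f : V → ι} (hf : Surjective f) :
    k * Nat.card ι ≤ {e ∈ G.edgeSet | ¬ (e.map f).IsDiag}.ncard := by
  classical
  have := Fintype.ofFinite ι
  have := Fintype.ofFinite V
  set X := {e ∈ G.edgeSet | ¬ (e.map f).IsDiag}
  have hfibre (c : ι) : 2 * k ≤ {e ∈ X | c ∈ e.map f}.ncard := by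
    by_contra! hlt
    obtain ⟨d, hd⟩ := exists_ne c
    obtain ⟨u, hu⟩ := hf c
    obtain ⟨v, hv⟩ := hf d
    obtain ⟨p⟩ := (hG _ (fun e he ↦ he.1.1) hlt).preconnected u v
    obtain ⟨a, -, ha, hb⟩ := p.exists_boundary_dart (f ⁻¹' {c}) hu (by simpa [hv] using hd)
    have hadj := a.adj
    rw [deleteEdges_adj] at hadj
    refine hadj.2 ⟨⟨hadj.1, ?_⟩, ?_⟩
    · simpa [Sym2.map_mk, show f a.fst = c from ha] using Ne.symm hb
    · simp [Sym2.map_mk, show f a.fst = c from ha]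
  have hcount := Finset.card_mul_le_card_mul (s := (Finset.univ : Finset ι)) (t := X.toFinset)
    (m := 2 * k) (n := 2) (fun c e ↦ c ∈ e.map f) (fun c _ ↦ ?_) (fun e _ ↦ ?_)
  · rw [Finset.card_univ, ← Nat.card_eq_fintype_card, ← Set.ncard_eq_toFinset_card'] at hcount
    linarith
  · rw [← Set.ncard_coe_finset]
    simpa [Finset.coe_bipartiteAbove] using hfibre c
  · induction e with
    | h a b =>
    refine (Finset.card_le_card (t := {f a, f b}) fun c hc ↦ ?_).trans Finset.card_le_two
    simpa [Finset.mem_bipartiteBelow, Sym2.map_mk, eq_comm] using hc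

/-- A family of pairwise edge-disjoint forests in `G`. -/
structure IsForestPacking (G : SimpleGraph V) (F : ι → SimpleGraph V) : Prop where
  le (i : ι) : F i ≤ G
  isAcyclic (i : ι) : (F i).IsAcyclic
  disjoint : Pairwise (Disjoint on F)

/-- A member of a forest packing may be replaced by a subforest plus an unused edge joining two of
its components. -/
theorem IsForestPacking.update_sup_edge [DecidableEq ι] (hF : G.IsForestPacking F) {i : ι}
    {x y : V} (hxy : G.Adj x y) (hnew : ∀ j, ¬ (F j).Adj x y) (hH : H ≤ F i)
    (hr : ¬ H.Reachable x y) : G.IsForestPacking (update F i (H ⊔ edge x y)) where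
  le j := by
    obtain rfl | hj := eq_or_ne j i
    · rw [update_self]
      exact sup_le (hH.trans (hF.le j)) ((edge_le_iff _).2 (.inr hxy))
    · rw [update_of_ne hj]
      exact hF.le j
  isAcyclic j := by
    obtain rfl | hj := eq_or_ne j i
    · rw [update_self]
      exact ((hF.isAcyclic j).anti hH).sup_edge_of_not_reachable hr
    · rw [update_of_ne hj]
      exact hF.isAcyclic j
  disjoint := by
    have key {j : ι} (hj : j ≠ i) : Disjoint (F j) (H ⊔ edge x y) :=
      ((hF.disjoint hj).mono_right hH).sup_right ((disjoint_edge _).2 (hnew j))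
    intro a b hab
    simp only [onFun, update_apply]
    split_ifs with ha hb hb
    · exact absurd (ha.trans hb.symm) hab
    · exact (key hb).symm
    · exact key ha
    · exact hF.disjoint hab

/-- The packing `F₁` arises from `F` by replacing an edge `e` of some forest by an unused edge `xy`
of `G`, where `e` separates `x` from `y` in that forest. -/
def ForestExchange [DecidableEq ι] (G : SimpleGraph V) (F F₁ : ι → SimpleGraph V) : Prop :=
  ∃ (i : ι) (x y : V) (e : Sym2 V), G.Adj x y ∧ (∀ j, ¬ (F j).Adj x y) ∧ e ∈ (F i).edgeSet ∧
    ¬ ((F i).deleteEdges {e}).Reachable x y ∧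
    F₁ = update F i ((F i).deleteEdges {e} ⊔ edge x y)

/-- The total number of edges of a family of graphs. -/
noncomputable def packingSize [Fintype ι] (F : ι → SimpleGraph V) : ℕ :=
  ∑ i, (F i).edgeSet.ncard

/-- Replacing one member changes the size of a family by the change of that member. -/
theorem packingSize_update [Fintype ι] [DecidableEq ι] (F : ι → SimpleGraph V) (i : ι)
    (H : SimpleGraph V) :
    packingSize (update F i H) + (F i).edgeSet.ncard = packingSize F + H.edgeSet.ncard := by
  unfold packingSize
  rw [← Finset.add_sum_erase _ _ (Finset.mem_univ i),
    ← Finset.add_sum_erase _ (fun j ↦ (F j).edgeSet.ncard) (Finset.mem_univ i), update_self,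
    Finset.sum_congr rfl fun j hj ↦ by rw [update_of_ne (Finset.ne_of_mem_erase hj)]]
  ring

theorem ncard_edgeSet_sup_edge [Finite V] {x y : V} (hxy : x ≠ y) (hH : ¬ H.Adj x y) :
    (H ⊔ edge x y).edgeSet.ncard = H.edgeSet.ncard + 1 := by
  rw [edgeSet_sup, edgeSet_edge_of_ne hxy, Set.union_singleton, Set.ncard_insert_of_notMem]
  exact hH

/-- In a maximum forest packing, every forest joins the ends of each unused edge. -/
theorem IsForestPacking.reachable_of_maximalFor [Finite V] [Fintype ι]
    (hF : MaximalFor G.IsForestPacking packingSize F) {x y : V} (hxy : G.Adj x y)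
    (hnew : ∀ j, ¬ (F j).Adj x y) (i : ι) : (F i).Reachable x y := by
  classical
  by_contra hr
  have hsize := packingSize_update F i (F i ⊔ edge x y)
  rw [ncard_edgeSet_sup_edge hxy.ne (hnew i)] at hsize
  have := hF.2 (hF.1.update_sup_edge hxy hnew le_rfl hr) (by omega)
  omega

/-- Exchanges preserve maximum forest packings. -/
theorem ForestExchange.maximalFor [Finite V] [Fintype ι] [DecidableEq ι]
    (h : G.ForestExchange F F₁) (hF : MaximalFor G.IsForestPacking packingSize F) :
    MaximalFor G.IsForestPacking packingSize F₁ := by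
  obtain ⟨i, x, y, e, hxy, hnew, he, hr, rfl⟩ := h
  have hsize := packingSize_update F i ((F i).deleteEdges {e} ⊔ edge x y)
  rw [ncard_edgeSet_sup_edge hxy.ne fun h ↦ hnew i (deleteEdges_le _ h), edgeSet_deleteEdges,
    Set.ncard_sdiff_singleton_add_one he] at hsize
  refine ⟨hF.1.update_sup_edge hxy hnew (deleteEdges_le _) hr, fun F' hF' hle ↦ ?_⟩
  have := hF.2 hF' (by omega)
  omega

theorem ForestExchange.maximalFor_of_reflTransGen [Finite V] [Fintype ι] [DecidableEq ι]
    (h : Relation.ReflTransGen G.ForestExchange F F₁)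
    (hF : MaximalFor G.IsForestPacking packingSize F) :
    MaximalFor G.IsForestPacking packingSize F₁ := by
  induction h with
  | refl => exact hF
  | tail _ h ih => exact h.maximalFor ih

/-- The edges of `G` that are unused by some packing obtained from `F` by exchanges. -/
def exchangeGraph [DecidableEq ι] (G : SimpleGraph V) (F : ι → SimpleGraph V) :
    SimpleGraph V where
  Adj x y := G.Adj x y ∧
    ∃ F₁, Relation.ReflTransGen G.ForestExchange F F₁ ∧ ∀ j, ¬ (F₁ j).Adj x y
  symm := ⟨fun _ _ ⟨h, F₁, hF₁, hnew⟩ ↦ ⟨h.symm, F₁, hF₁, fun j hj ↦ hnew j hj.symm⟩⟩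
  loopless := ⟨fun _ h ↦ h.1.ne rfl⟩

/-- The path of a forest joining the ends of an unused edge lies in the exchange graph. -/
theorem reachable_inf_exchangeGraph_of_unused [Finite V] [Fintype ι] [DecidableEq ι]
    (hF : MaximalFor G.IsForestPacking packingSize F)
    (hF₀ : Relation.ReflTransGen G.ForestExchange F₀ F) {x y : V} (hxy : G.Adj x y)
    (hnew : ∀ j, ¬ (F j).Adj x y) (i : ι) :
    (F i ⊓ G.exchangeGraph F₀).Reachable x y := by
  obtain ⟨p, hp⟩ := (IsForestPacking.reachable_of_maximalFor hF hxy hnew i).exists_isPath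
  refine ⟨p.transfer _ fun e he ↦ ?_⟩
  have hr := (hF.1.isAcyclic i).not_reachable_deleteEdges ⟨p, hp⟩ he
  have heF := p.edges_subset_edgeSet he
  induction e with
  | h a b =>
  refine ⟨heF, hF.1.le i heF, _, hF₀.tail ⟨i, x, y, _, hxy, hnew, heF, hr, rfl⟩, fun j hj ↦ ?_⟩
  obtain rfl | hji := eq_or_ne j i
  · rw [update_self, sup_adj, deleteEdges_adj, adj_edge] at hj
    obtain hj | hj := hj
    · exact hj.2 rfl
    · exact hnew j (by rwa [← mem_edgeSet, hj.1])
  · rw [update_of_ne hji] at hj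
    exact (hF.1.disjoint hji).le_bot ⟨hj, heF⟩

/-- Within the exchange graph, the forests of the original maximum packing join all vertices joined
by forests of packings obtained by exchanges. -/
theorem reachable_inf_exchangeGraph_of_reflTransGen [Finite V] [Fintype ι] [DecidableEq ι]
    (hF₀ : MaximalFor G.IsForestPacking packingSize F₀)
    (hF : Relation.ReflTransGen G.ForestExchange F₀ F) {i : ι} {u v : V}
    (huv : (F i ⊓ G.exchangeGraph F₀).Reachable u v) :
    (F₀ i ⊓ G.exchangeGraph F₀).Reachable u v := by
  induction hF generalizing u v with
  | refl => exact huv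
  | tail hF h ih =>
    refine ih (huv.of_forall_adj fun a b hab ↦ ?_)
    obtain ⟨l, x, y, e, hxy, hnew, he, hr, rfl⟩ := h
    obtain ⟨hab, hQ⟩ := hab
    obtain rfl | hil := eq_or_ne i l
    · rw [update_self, sup_adj, edge_adj] at hab
      have hr := reachable_inf_exchangeGraph_of_unused
        (ForestExchange.maximalFor_of_reflTransGen hF hF₀) hF hxy hnew i
      obtain hab | ⟨⟨rfl, rfl⟩ | ⟨rfl, rfl⟩, -⟩ := hab
      · exact Adj.reachable ⟨deleteEdges_le _ hab, hQ⟩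
      · exact hr
      · exact hr.symm
    · rw [update_of_ne hil] at hab
      exact Adj.reachable ⟨hab, hQ⟩

/-- Each forest of a maximum packing spans every component of the exchange graph. -/
theorem reachable_inf_exchangeGraph [Finite V] [Fintype ι] [DecidableEq ι]
    (hF : MaximalFor G.IsForestPacking packingSize F) {u v : V}
    (huv : (G.exchangeGraph F).Reachable u v) (i : ι) :
    (F i ⊓ G.exchangeGraph F).Reachable u v := by
  refine huv.of_forall_adj fun a b hab ↦ ?_
  obtain ⟨hab, F₁, hF₁, hnew⟩ := hab
  exact reachable_inf_exchangeGraph_of_reflTransGen hF hF₁ <|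
    reachable_inf_exchangeGraph_of_unused
      (ForestExchange.maximalFor_of_reflTransGen hF₁ hF) hF₁ hab hnew i

/-- A forest of a maximum packing has fewer edges outside the exchange graph than the exchange
graph has components. -/
theorem ncard_edgeSet_sdiff_exchangeGraph_lt [Finite V] [Nonempty V] [Fintype ι] [DecidableEq ι]
    (hF : MaximalFor G.IsForestPacking packingSize F) (i : ι) :
    ((F i).edgeSet \ (G.exchangeGraph F).edgeSet).ncard <
      Nat.card (G.exchangeGraph F).ConnectedComponent := by
  have hle := (hF.1.isAcyclic i).ncard_edgeSet_sdiff_add_card_le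
    (inf_le_left : F i ⊓ G.exchangeGraph F ≤ F i)
  rw [edgeSet_inf, Set.sdiff_self_inter] at hle
  have hinj : Injective (ConnectedComponent.map
      (Hom.ofLE (inf_le_right : F i ⊓ G.exchangeGraph F ≤ G.exchangeGraph F))) := by
    refine ConnectedComponent.ind₂ fun u v h ↦ ?_
    exact ConnectedComponent.sound (reachable_inf_exchangeGraph hF (ConnectedComponent.exact h) i)
  have := Nat.card_le_card_of_injective _ hinj
  have : 0 < Nat.card (F i).ConnectedComponent := Nat.card_pos
  omega

/-- If `G` remains connected after deleting fewer than `2 * k` edges, then the exchange graph of a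
maximum packing of `k` forests is connected. -/
theorem preconnected_exchangeGraph [Finite V] [Nonempty V] [Fintype ι] [DecidableEq ι] [Nonempty ι]
    (hG : ∀ D ⊆ G.edgeSet, D.ncard < 2 * Fintype.card ι → (G.deleteEdges D).Connected)
    (hF : MaximalFor G.IsForestPacking packingSize F) : (G.exchangeGraph F).Preconnected := by
  set Q := G.exchangeGraph F
  by_contra hns
  have : Nontrivial Q.ConnectedComponent := by
    rw [← not_subsingleton_iff_nontrivial]
    exact fun h ↦ hns fun u v ↦ ConnectedComponent.exact (Subsingleton.elim _ _)
  have hcross := mul_card_le_ncard_crossing hG (f := Q.connectedComponentMk)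
    fun c ↦ c.exists_rep
  have hsub : {e ∈ G.edgeSet | ¬ (e.map Q.connectedComponentMk).IsDiag} ⊆
      ⋃ i ∈ Finset.univ, (F i).edgeSet \ Q.edgeSet := by
    rintro ⟨a, b⟩ ⟨hab, hdiag⟩
    have hnQ : ¬ Q.Adj a b := fun h ↦ hdiag (ConnectedComponent.sound h.reachable)
    have : ∃ i, (F i).Adj a b := by
      by_contra! hnew
      exact hnQ ⟨hab, F, .refl, hnew⟩
    obtain ⟨i, hi⟩ := this
    exact Set.mem_biUnion (Finset.mem_coe.2 (Finset.mem_univ i)) ⟨hi, hnQ⟩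
  have hlt := calc
    {e ∈ G.edgeSet | ¬ (e.map Q.connectedComponentMk).IsDiag}.ncard
      ≤ (⋃ i ∈ Finset.univ, (F i).edgeSet \ Q.edgeSet).ncard := Set.ncard_le_ncard hsub
    _ ≤ ∑ i, ((F i).edgeSet \ Q.edgeSet).ncard := Finset.set_ncard_biUnion_le _ _
    _ < ∑ _i : ι, Nat.card Q.ConnectedComponent :=
      Finset.sum_lt_sum_of_nonempty Finset.univ_nonempty fun i _ ↦
        ncard_edgeSet_sdiff_exchangeGraph_lt hF i
    _ = Fintype.card ι * Nat.card Q.ConnectedComponent := by simp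
  omega

/-- A finite graph that remains connected after deleting fewer than `2 * |ι|` edges contains a
family of pairwise edge-disjoint spanning trees indexed by `ι`. -/
theorem exists_isTree_pairwise_disjoint [Finite V] [Nonempty V] [Fintype ι]
    (hG : ∀ D ⊆ G.edgeSet, D.ncard < 2 * Fintype.card ι → (G.deleteEdges D).Connected) :
    ∃ T : ι → SimpleGraph V, (∀ i, T i ≤ G ∧ (T i).IsTree) ∧ Pairwise (Disjoint on T) := by
  classical
  have hne : {F : ι → SimpleGraph V | G.IsForestPacking F}.Nonempty :=
    ⟨fun _ ↦ ⊥, fun _ ↦ bot_le, fun _ ↦ isAcyclic_bot, fun _ _ _ ↦ disjoint_bot_left⟩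
  obtain ⟨F, hF⟩ := (Set.toFinite _).exists_maximalFor packingSize _ hne
  refine ⟨F, fun i ↦ ⟨hF.1.le i, ⟨⟨fun u v ↦ ?_⟩, hF.1.isAcyclic i⟩⟩, hF.1.disjoint⟩
  have : Nonempty ι := ⟨i⟩
  exact (reachable_inf_exchangeGraph hF (preconnected_exchangeGraph hG hF u v) i).mono inf_le_left

end SimpleGraph

/-- (Gusfield) If `G` is a finite connected simple graph such that deleting any
set of fewer than `2k` edges leaves a connected graph (i.e. `G` is
`2k`-edge-connected), then `G` has `k` pairwise edge-disjoint spanning trees;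
equivalently, `λ(G) ≤ 2σ(G)`. -/
theorem gusfield {V : Type*} [Fintype V]
    (G : SimpleGraph V) (hG : G.Connected) (k : ℕ)
    (hconn : ∀ D ⊆ G.edgeSet, D.ncard < 2 * k → (G.deleteEdges D).Connected) :
    MaxSTP.HasDisjointSpanningTrees G k := by
  have := hG.nonempty
  obtain ⟨T, hT, hdisj⟩ := SimpleGraph.exists_isTree_pairwise_disjoint (ι := Fin k) (G := G)
    (by simpa using hconn)
  exact ⟨T, hT, fun i j hij ↦ SimpleGraph.disjoint_edgeSet.2 (hdisj hij)⟩
end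

section
/- Let G be a finite connected simple graph possessing k pairwise edge-disjoint spanning trees, and let D₁ and D₂ be two distinct minimal disconnecting edge sets of G, each of size exactly k. Then D₁ and D₂ have no edge in common: D₁ ∩ D₂ = ∅. -/
open Set

namespace MaxSTP

variable {V : Type*}

/-- `D` is a disconnecting edge set of `G`: a set of edges of `G` whose deletion
leaves a graph that is not connected. -/
def IsDisconnectingSet (G : SimpleGraph V) (D : Set (Sym2 V)) : Prop :=
  D ⊆ G.edgeSet ∧ ¬ (G.deleteEdges D).Connected

end MaxSTP

namespace SimpleGraph

variable {V : Type*}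

/-- If the ends of every edge of `H` are joined in `K`, then vertices joined in `H` are
joined in `K`. -/
theorem Reachable.of_forall_adj_reachable {H K : SimpleGraph V}
    (h : ∀ a b, H.Adj a b → K.Reachable a b) {a b : V} (hab : H.Reachable a b) :
    K.Reachable a b := by
  obtain ⟨p⟩ := hab
  induction p with
  | nil => exact Reachable.rfl
  | cons hadj _ ih => exact (h _ _ hadj).trans ih

/-- If the ends of every edge of a connected graph `H` are joined in `K`, then `K` is
connected. -/
theorem Connected.of_forall_adj_reachable {H K : SimpleGraph V} (hH : H.Connected)
    (h : ∀ a b, H.Adj a b → K.Reachable a b) : K.Connected :=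
  have := hH.nonempty
  ⟨fun a b => (hH.preconnected a b).of_forall_adj_reachable h⟩

/-- After deleting an edge `s(u, v)` of a connected graph, every vertex is joined to `u`
or to `v`. -/
theorem Connected.reachable_or_reachable_deleteEdges {H : SimpleGraph V} (hH : H.Connected)
    (u v w : V) :
    (H.deleteEdges {s(u, v)}).Reachable w u ∨ (H.deleteEdges {s(u, v)}).Reachable w v := by
  obtain ⟨p⟩ := hH.preconnected w u
  induction p with
  | nil => exact Or.inl Reachable.rfl
  | @cons a b c hadj p ih =>
    by_cases hab : s(a, b) = s(c, v)
    · rcases Sym2.eq_iff.1 hab with ⟨rfl, -⟩ | ⟨rfl, -⟩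
      · exact Or.inl Reachable.rfl
      · exact Or.inr Reachable.rfl
    · have hadj' : (H.deleteEdges {s(c, v)}).Adj a b := deleteEdges_adj.2 ⟨hadj, hab⟩
      exact ih.imp hadj'.reachable.trans hadj'.reachable.trans

end SimpleGraph

namespace MaxSTP

variable {V : Type*} {G H : SimpleGraph V} {D D₁ D₂ : Set (Sym2 V)}

theorem IsDisconnectingSet.inter_edgeSet_nonempty (hD : IsDisconnectingSet G D)
    (hHG : H ≤ G) (hH : H.Connected) : (D ∩ H.edgeSet).Nonempty := by
  by_contra hempty
  refine hD.2 (hH.mono fun a b hab => SimpleGraph.deleteEdges_adj.2 ⟨hHG hab, fun hmem => ?_⟩)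
  exact hempty ⟨s(a, b), hmem, hab⟩

/-- The ends of an edge of a minimal disconnecting set are separated by deleting the set. -/
theorem not_reachable_of_minimal (hD : Minimal (IsDisconnectingSet G) D) {x y : V}
    (hxy : s(x, y) ∈ D) : ¬ (G.deleteEdges D).Reachable x y := by
  intro hr
  have hdisc : IsDisconnectingSet G (D \ {s(x, y)}) := by
    refine ⟨sdiff_subset.trans hD.prop.1, fun hconn => hD.prop.2 ?_⟩
    refine hconn.of_forall_adj_reachable fun a b hab => ?_
    rw [SimpleGraph.deleteEdges_adj] at hab
    by_cases he : s(a, b) = s(x, y)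
    · rcases Sym2.eq_iff.1 he with ⟨rfl, rfl⟩ | ⟨rfl, rfl⟩
      · exact hr
      · exact hr.symm
    · exact (SimpleGraph.deleteEdges_adj.2 ⟨hab.1, fun hmem => hab.2 ⟨hmem, he⟩⟩).reachable
  exact (hD.le_of_le hdisc sdiff_subset hxy).2 rfl

/-- A minimal disconnecting set meeting a connected spanning subgraph `H` in at most the edge
`e` is contained in every disconnecting set with that property. -/
theorem subset_of_inter_edgeSet_subset_singleton (hHG : H ≤ G) (hH : H.Connected) {e : Sym2 V}
    (hD₁ : Minimal (IsDisconnectingSet G) D₁) (hD₂ : IsDisconnectingSet G D₂)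
    (h₁ : D₁ ∩ H.edgeSet ⊆ {e}) (h₂ : D₂ ∩ H.edgeSet ⊆ {e}) : D₁ ⊆ D₂ := by
  have hle : ∀ D : Set (Sym2 V), D ∩ H.edgeSet ⊆ {e} → H.deleteEdges {e} ≤ G.deleteEdges D := by
    intro D hD a b hab
    rw [SimpleGraph.deleteEdges_adj] at hab ⊢
    exact ⟨hHG hab.1, fun hmem => hab.2 (hD ⟨hmem, hab.1⟩)⟩
  intro f hf
  by_contra hf₂
  induction f using Sym2.ind with
  | _ x y =>
  induction e using Sym2.ind with
  | _ u v =>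
  have hsep : ¬ (H.deleteEdges {s(u, v)}).Reachable x y := fun hr =>
    not_reachable_of_minimal hD₁ hf (hr.mono (hle D₁ h₁))
  have hxy : (G.deleteEdges D₂).Reachable x y :=
    (SimpleGraph.deleteEdges_adj.2 ⟨hD₁.prop.1 hf, hf₂⟩ : (G.deleteEdges D₂).Adj x y).reachable
  have huv : (G.deleteEdges D₂).Reachable u v := by
    rcases hH.reachable_or_reachable_deleteEdges u v x with hx | hx <;>
      rcases hH.reachable_or_reachable_deleteEdges u v y with hy | hy
    · exact absurd (hx.trans hy.symm) hsep
    · exact ((hx.mono (hle D₂ h₂)).symm.trans hxy).trans (hy.mono (hle D₂ h₂))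
    · exact ((hy.mono (hle D₂ h₂)).symm.trans hxy.symm).trans (hx.mono (hle D₂ h₂))
    · exact absurd (hx.trans hy.symm) hsep
  refine hD₂.2 (hH.of_forall_adj_reachable fun a b hab => ?_)
  by_cases he : s(a, b) = s(u, v)
  · rcases Sym2.eq_iff.1 he with ⟨rfl, rfl⟩ | ⟨rfl, rfl⟩
    · exact huv
    · exact huv.symm
  · exact (hle D₂ h₂ (SimpleGraph.deleteEdges_adj.2 ⟨hab, he⟩)).reachable

end MaxSTP

/-- If a set of `k` elements meets each of `k` pairwise disjoint sets, then each of its elements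
lies in one of them, and is its only element there. -/
theorem Set.exists_mem_and_inter_subsingleton_of_pairwise_disjoint {α : Type*} {k : ℕ} {D : Set α}
    (hfin : D.Finite) (hcard : D.ncard = k) {S : Fin k → Set α}
    (hS : Pairwise (Function.onFun Disjoint S)) (hne : ∀ i, (D ∩ S i).Nonempty) :
    (∀ d ∈ D, ∃ i, d ∈ S i) ∧ ∀ i, (D ∩ S i).Subsingleton := by
  have := hfin.fintype
  choose g hgD hgS using hne
  have huniq : ∀ {i j d}, d ∈ S i → d ∈ S j → i = j := fun hi hj =>
    by_contra fun hij => Set.disjoint_left.1 (hS hij) hi hj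
  have hinj : Function.Injective fun i => (⟨g i, hgD i⟩ : D) := fun i j hij => by
    have hij' : g i = g j := congrArg Subtype.val hij
    exact huniq (hgS i) (hij' ▸ hgS j)
  have hsurj := (hinj.bijective_of_nat_card_le
    (by rw [Nat.card_coe_set_eq, hcard, Nat.card_fin])).surjective
  have hex : ∀ d ∈ D, ∃ i, g i = d := fun d hd =>
    (hsurj ⟨d, hd⟩).imp fun _ hi => congrArg Subtype.val hi
  refine ⟨fun d hd => (hex d hd).imp fun i (hi : g i = d) => hi ▸ hgS i, fun i a ha b hb => ?_⟩
  obtain ⟨ja, rfl⟩ := hex a ha.1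
  obtain ⟨jb, rfl⟩ := hex b hb.1
  rw [huniq (hgS ja) ha.2, huniq (hgS jb) hb.2]

/-- If a finite connected simple graph `G` has `k` pairwise edge-disjoint
spanning trees, then any two distinct minimal disconnecting edge sets of `G` of
size exactly `k` have no edge in common. -/
theorem distinct_min_cuts_disjoint {V : Type*} [Fintype V]
    (G : SimpleGraph V) (hG : G.Connected) (k : ℕ)
    (htrees : MaxSTP.HasDisjointSpanningTrees G k)
    (D₁ D₂ : Set (Sym2 V))
    (hD₁ : Minimal (MaxSTP.IsDisconnectingSet G) D₁)
    (hD₂ : Minimal (MaxSTP.IsDisconnectingSet G) D₂)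
    (hk₁ : D₁.ncard = k) (hk₂ : D₂.ncard = k) (hne : D₁ ≠ D₂) :
    D₁ ∩ D₂ = ∅ := by
  obtain ⟨T, hT, hdisj⟩ := htrees
  have hmeet : ∀ {D : Set (Sym2 V)}, Minimal (MaxSTP.IsDisconnectingSet G) D → D.ncard = k →
      (∀ d ∈ D, ∃ i, d ∈ (T i).edgeSet) ∧ ∀ i, (D ∩ (T i).edgeSet).Subsingleton :=
    fun hD hk => Set.exists_mem_and_inter_subsingleton_of_pairwise_disjoint (Set.toFinite _) hk hdisj
      fun i => hD.prop.inter_edgeSet_nonempty (hT i).1 (hT i).2.connected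
  refine Set.eq_empty_of_forall_notMem fun e he => hne ?_
  obtain ⟨i, hi⟩ := (hmeet hD₁ hk₁).1 e he.1
  have h₁ : D₁ ∩ (T i).edgeSet ⊆ {e} := fun d hd => (hmeet hD₁ hk₁).2 i hd ⟨he.1, hi⟩
  have h₂ : D₂ ∩ (T i).edgeSet ⊆ {e} := fun d hd => (hmeet hD₂ hk₂).2 i hd ⟨he.2, hi⟩
  exact Set.Subset.antisymm
    (MaxSTP.subset_of_inter_edgeSet_subset_singleton (hT i).1 (hT i).2.connected
      hD₁ hD₂.prop h₁ h₂)
    (MaxSTP.subset_of_inter_edgeSet_subset_singleton (hT i).1 (hT i).2.connected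
      hD₂ hD₁.prop h₂ h₁)
end
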